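/- Let 1 < p < ∞ and suppose there is a constant M such that ‖[b,T]f‖_{L^{p,∞}} ≤ M ‖f‖_{L^p} for every bounded measurable complex-valued function f supported in a cube. Then b ∈ BMO and ‖b‖_* ≤ C M, where C depends only on n, p and Ω. -/

import Mathlib

open MeasureTheory ENNReal

noncomputable section

/-- `ℝⁿ` with the Euclidean norm. -/
abbrev En (n : ℕ) := EuclideanSpace ℝ (Fin n)

/-- The open cube in `ℝⁿ` centered at `c` with half side length `r`. -/
def cube {n : ℕ} (c : En n) (r : ℝ) : Set (En n) := {y | ∀ i, |y i - c i| < r}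

/-- Morrey norm `‖f‖_{M^p_q}`. -/
def morreyNorm {n : ℕ} (p q : ℝ) (f : En n → ℂ) : ℝ≥0∞ :=
  ⨆ (c : En n) (r : ℝ) (_ : 0 < r),
    volume (cube c r) ^ (1 / p - 1 / q) *
      (∫⁻ y in cube c r, (‖f y‖₊ : ℝ≥0∞) ^ q) ^ (1 / q)

/-- Weak Morrey norm `‖f‖_{WM^p_q}`. -/
def weakMorreyNorm {n : ℕ} (p q : ℝ) (f : En n → ℂ) : ℝ≥0∞ :=
  ⨆ (c : En n) (r : ℝ) (_ : 0 < r),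
    volume (cube c r) ^ (1 / p - 1 / q) *
      ⨆ (t : ℝ) (_ : 0 < t),
        (ENNReal.ofReal t ^ q * volume {y ∈ cube c r | t < ‖f y‖}) ^ (1 / q)

/-- Weak Lebesgue quasinorm `‖f‖_{L^{p,∞}}`. -/
def weakLpNorm {n : ℕ} (p : ℝ) (f : En n → ℂ) : ℝ≥0∞ :=
  ⨆ (t : ℝ) (_ : 0 < t),
    ENNReal.ofReal t * volume {x : En n | t < ‖f x‖} ^ (1 / p)

/-- The average `b_Q` of `b` over the cube `Q = cube c r`. -/
def cubeAvg {n : ℕ} (b : En n → ℝ) (c : En n) (r : ℝ) : ℝ :=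
  (∫ x in cube c r, b x) / (volume (cube c r)).toReal

/-- The BMO seminorm `‖b‖_*`. -/
def bmoSeminorm {n : ℕ} (b : En n → ℝ) : ℝ≥0∞ :=
  ⨆ (c : En n) (r : ℝ) (_ : 0 < r),
    (volume (cube c r))⁻¹ *
      ∫⁻ x in cube c r, (‖b x - cubeAvg b c r‖₊ : ℝ≥0∞)

/-- The Lipschitz (Hölder) seminorm `‖b‖_{Lip_α}`. -/
def lipSeminorm {n : ℕ} (α : ℝ) (b : En n → ℝ) : ℝ≥0∞ :=
  ⨆ (x : En n) (y : En n) (_ : x ≠ y),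
    (‖b x - b y‖₊ : ℝ≥0∞) / edist x y ^ α

/-- `sup_Q |Q|^{-(1+α/n)} ∫_Q |b - b_Q|`. -/
def lipAvgNorm {n : ℕ} (α : ℝ) (b : En n → ℝ) : ℝ≥0∞ :=
  ⨆ (c : En n) (r : ℝ) (_ : 0 < r),
    volume (cube c r) ^ (-(1 + α / (n : ℝ))) *
      ∫⁻ x in cube c r, (‖b x - cubeAvg b c r‖₊ : ℝ≥0∞)


/-- The closed cube. -/
def ccube {n : ℕ} (c : En n) (r : ℝ) : Set (En n) := {y | ∀ i, |y i - c i| ≤ r}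

lemma cube_subset_ccube {n : ℕ} (c : En n) (r : ℝ) : cube c r ⊆ ccube c r :=
  fun _ hy i => (hy i).le

lemma isClosed_ccube {n : ℕ} (c : En n) (r : ℝ) : IsClosed (ccube c r) := by
  have : ccube c r = ⋂ i, {y : En n | |y i - c i| ≤ r} := by
    ext y; simp [ccube]
  rw [this]
  exact isClosed_iInter fun i => isClosed_le (by fun_prop) continuous_const

lemma norm_le_of_coord {n : ℕ} (w : En n) (R : ℝ) (hR : ∀ i, |w i| ≤ R) :
    ‖w‖ ≤ n * R := by
  have h := EuclideanSpace.norm_eq w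
  have hs : ‖w‖ ≤ ∑ i, |w i| := by
    rw [h]
    apply Real.sqrt_le_iff.2
    refine ⟨Finset.sum_nonneg fun i _ => abs_nonneg _, ?_⟩
    simp only [Real.norm_eq_abs]
    exact Finset.sum_sq_le_sq_sum_of_nonneg (fun i _ => abs_nonneg _)
  refine hs.trans ?_
  calc ∑ i, |w i| ≤ ∑ _i : Fin n, R := Finset.sum_le_sum fun i _ => hR i
    _ = n * R := by simp

lemma isCompact_ccube {n : ℕ} (c : En n) (r : ℝ) : IsCompact (ccube c r) := by
  apply Metric.isCompact_of_isClosed_isBounded (isClosed_ccube c r)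
  refine (Metric.isBounded_closedBall (x := c) (r := n * r)).subset ?_
  intro y hy
  rw [Metric.mem_closedBall, dist_eq_norm]
  exact norm_le_of_coord _ _ (fun i => by simpa using hy i)

lemma isOpen_cube {n : ℕ} (c : En n) (r : ℝ) : IsOpen (cube c r) := by
  have : cube c r = ⋂ i, {y : En n | |y i - c i| < r} := by
    ext y; simp [cube]
  rw [this]
  exact isOpen_iInter_of_finite fun i => isOpen_lt (by fun_prop) continuous_const

lemma volume_cube {n : ℕ} (c : En n) (r : ℝ) (hr : 0 < r) :
    volume (cube c r) = ENNReal.ofReal ((2 * r) ^ n) := by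
  have h1 : cube c r = (WithLp.ofLp : En n → (Fin n → ℝ)) ⁻¹'
      (Set.pi Set.univ fun i => Set.Ioo (c i - r) (c i + r)) := by
    ext y
    simp only [cube, Set.mem_ofPred_eq, Set.mem_preimage, Set.mem_pi, Set.mem_univ,
      true_implies, Set.mem_Ioo, abs_lt]
    refine forall_congr' fun i => ?_
    constructor <;> intro h <;> constructor <;> linarith [h.1, h.2]
  rw [h1, (PiLp.volume_preserving_ofLp (Fin n)).measure_preimage
    (MeasurableSet.univ_pi fun i => measurableSet_Ioo).nullMeasurableSet, Real.volume_pi_Ioo]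
  rw [ENNReal.ofReal_pow (by linarith)]
  simp only [show ∀ i, c i + r - (c i - r) = 2 * r by intro i; ring]
  simp

/-- Nondegeneracy of the kernel. -/
lemma kernel_lower {n : ℕ} (Ω : En n → ℝ)
    (hΩhom : ∀ l : ℝ, 0 < l → ∀ x : En n, x ≠ 0 → Ω (l • x) = Ω x)
    (hΩc : ContinuousOn Ω {(0 : En n)}ᶜ)
    (x0 : En n) (hx0 : x0 ≠ 0) (hΩ0 : Ω x0 ≠ 0) :
    ∃ A κ s : ℝ, 0 < A ∧ 0 < κ ∧ |s| = 1 ∧ ∀ (c : En n) (r : ℝ), 0 < r →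
      ∀ x ∈ cube (c + (A * r) • x0) r, ∀ y ∈ ccube c r,
        x - y ≠ 0 ∧ κ / r ^ n ≤ s * (Ω (x - y) / ‖x - y‖ ^ n) := by
  have hcont : ContinuousAt Ω x0 := hΩc.continuousAt (isOpen_compl_singleton.mem_nhds hx0)
  obtain ⟨δ0, hδ0, hδ⟩ := Metric.continuousAt_iff.1 hcont (|Ω x0| / 2) (by positivity)
  have hnx : 0 < ‖x0‖ := norm_pos_iff.2 hx0
  set δ := min δ0 ‖x0‖ with hδdef
  have hδpos : 0 < δ := lt_min hδ0 hnx
  set A : ℝ := (2 * n + 1) / δ with hA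
  have hApos : 0 < A := by positivity
  obtain ⟨s, hs1, hs⟩ : ∃ s : ℝ, |s| = 1 ∧ s * Ω x0 = |Ω x0| := by
    rcases lt_or_gt_of_ne hΩ0 with h | h
    · exact ⟨-1, by simp, by rw [abs_of_neg h]; ring⟩
    · exact ⟨1, by simp, by rw [abs_of_pos h]; ring⟩
  refine ⟨A, |Ω x0| / 2 / (A * (‖x0‖ + δ)) ^ n, s, hApos, by positivity, hs1, ?_⟩
  intro c r hr x hx y hy
  have hAr : 0 < A * r := by positivity
  set w : En n := x - y - (A * r) • x0 with hw
  have hwn : ‖w‖ ≤ n * (2 * r) := by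
    apply norm_le_of_coord
    intro i
    have h1 := hx i
    have h2 := hy i
    simp only [PiLp.add_apply, PiLp.smul_apply, smul_eq_mul] at h1
    have e : w i = (x i - (c i + A * r * x0 i)) - (y i - c i) := by
      simp [hw]; ring
    rw [e]
    calc _ ≤ |x i - (c i + A * r * x0 i)| + |y i - c i| := abs_sub _ _
      _ ≤ 2 * r := by linarith
  set z : En n := x0 + (A * r)⁻¹ • w with hz
  have hxy : x - y = (A * r) • z := by
    rw [hz, smul_add, smul_smul, mul_inv_cancel₀ hAr.ne', one_smul, hw]; abel
  have hzd : ‖(A * r)⁻¹ • w‖ < δ := by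
    rw [norm_smul, norm_inv, Real.norm_of_nonneg hAr.le, inv_mul_lt_iff₀ hAr]
    have : A * r * δ = (2 * n + 1) * r := by rw [hA]; field_simp
    rw [this]; nlinarith
  have hz0 : z ≠ 0 := by
    intro h0
    have : (A * r)⁻¹ • w = -x0 := by rw [hz] at h0; exact (neg_eq_of_add_eq_zero_right h0).symm
    rw [this, norm_neg] at hzd
    exact absurd hzd (not_lt.2 (min_le_right _ _))
  have hzn : ‖z‖ ≤ ‖x0‖ + δ := (norm_add_le _ _).trans (by linarith)
  have hΩz : |Ω x0| / 2 ≤ s * Ω z := by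
    have h1 := @hδ z (by
      rw [dist_eq_norm, hz, add_sub_cancel_left]; exact hzd.trans_le (min_le_left _ _))
    rw [Real.dist_eq] at h1
    have h2 : |s * (Ω z - Ω x0)| < |Ω x0| / 2 := by rw [abs_mul, hs1, one_mul]; exact h1
    have := (abs_lt.1 h2).1
    rw [mul_sub, hs] at this
    linarith
  refine ⟨by rw [hxy]; exact smul_ne_zero hAr.ne' hz0, ?_⟩
  rw [hxy, hΩhom _ hAr _ hz0, norm_smul, Real.norm_of_nonneg hAr.le, div_div, ← mul_pow,
    ← mul_div_assoc]
  have : 0 < ‖z‖ := norm_pos_iff.2 hz0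
  have h3 : A * r * ‖z‖ ≤ A * (‖x0‖ + δ) * r := by
    calc A * r * ‖z‖ ≤ A * r * (‖x0‖ + δ) := by gcongr
      _ = _ := by ring
  gcongr
  exact le_trans (by positivity) hΩz

/-- Existence of a median. -/
lemma exists_median {X : Type*} [MeasurableSpace X] (μ : Measure X) [IsFiniteMeasure μ]
    (b : X → ℝ) (hb : Measurable b) :
    ∃ α : ℝ, μ Set.univ / 2 ≤ μ {x | b x ≤ α} ∧ μ Set.univ / 2 ≤ μ {x | α ≤ b x} := by
  by_cases hμ : μ Set.univ = 0
  · exact ⟨0, by simp [hμ], by simp [hμ]⟩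
  have hhalf : μ Set.univ / 2 < μ Set.univ := ENNReal.half_lt_self hμ (measure_ne_top _ _)
  have hhalf0 : 0 < μ Set.univ / 2 := ENNReal.half_pos hμ
  have hmono : Monotone fun t : ℝ => {x | b x ≤ t} := fun s t hst x hx => le_trans hx hst
  set S : Set ℝ := {t | μ Set.univ / 2 ≤ μ {x | b x ≤ t}} with hS
  have hup : ∀ s ∈ S, ∀ t, s ≤ t → t ∈ S := fun s hs t hst =>
    le_trans hs (measure_mono (hmono hst))
  have hne : S.Nonempty := by
    have h := tendsto_measure_iUnion_atTop (μ := μ) hmono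
    have hU : (⋃ t : ℝ, {x | b x ≤ t}) = Set.univ :=
      Set.eq_univ_of_forall fun x => Set.mem_iUnion.2 ⟨b x, by simp⟩
    rw [hU] at h
    obtain ⟨t, ht⟩ := (h.eventually (lt_mem_nhds hhalf)).exists
    exact ⟨t, ht.le⟩
  have hbdd : BddBelow S := by
    have h := tendsto_measure_iInter_atBot (μ := μ) (s := fun t : ℝ => {x | b x ≤ t})
      (fun t => (measurableSet_le hb measurable_const).nullMeasurableSet) hmono
      ⟨0, measure_ne_top _ _⟩
    have hI : (⋂ t : ℝ, {x | b x ≤ t}) = ∅ := by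
      refine Set.eq_empty_of_forall_notMem fun x hx => ?_
      have := Set.mem_iInter.1 hx (b x - 1)
      simp only [Set.mem_ofPred_eq] at this
      linarith
    rw [hI, measure_empty] at h
    obtain ⟨t, ht⟩ := (h.eventually (gt_mem_nhds hhalf0)).exists
    refine ⟨t, fun s hs => ?_⟩
    by_contra hlt
    exact absurd (hup s hs t (not_le.1 hlt).le) (not_le.2 ht)
  have hu : Filter.Tendsto (fun k : ℕ => 1 / ((k : ℝ) + 1)) Filter.atTop (nhds 0) :=
    tendsto_one_div_add_atTop_nhds_zero_nat
  have hanti : Antitone fun k : ℕ => 1 / ((k : ℝ) + 1) := fun i j hij =>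
    one_div_le_one_div_of_le (by positivity) (by exact_mod_cast Nat.succ_le_succ hij)
  refine ⟨sInf S, ?_, ?_⟩
  · have hI : {x | b x ≤ sInf S} = ⋂ k : ℕ, {x | b x ≤ sInf S + 1 / ((k : ℝ) + 1)} := by
      ext x
      simp only [Set.mem_ofPred_eq, Set.mem_iInter]
      constructor
      · intro h k
        have : 0 < 1 / ((k : ℝ) + 1) := by positivity
        linarith
      · intro h
        have := ge_of_tendsto' (hu.const_add (sInf S)) h
        simpa using this
    rw [hI]
    refine ge_of_tendsto' (tendsto_measure_iInter_atTop (μ := μ)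
      (s := fun k : ℕ => {x | b x ≤ sInf S + 1 / ((k : ℝ) + 1)})
      (fun t => (measurableSet_le hb measurable_const).nullMeasurableSet) ?_
      ⟨0, measure_ne_top _ _⟩) ?_
    · intro i j hij x hx
      have := hanti hij
      simp only [Set.mem_ofPred_eq] at hx ⊢
      simp only at this
      linarith
    · intro k
      have hpos : 0 < 1 / ((k : ℝ) + 1) := by positivity
      obtain ⟨s, hs, hlt⟩ := exists_lt_of_csInf_lt hne
        (show sInf S < sInf S + 1 / ((k : ℝ) + 1) by linarith)
      exact hup s hs _ hlt.le
  · have hlt : μ {x | b x < sInf S} ≤ μ Set.univ / 2 := by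
      have hU : {x | b x < sInf S} = ⋃ k : ℕ, {x | b x ≤ sInf S - 1 / ((k : ℝ) + 1)} := by
        ext x
        simp only [Set.mem_ofPred_eq, Set.mem_iUnion]
        constructor
        · intro h
          obtain ⟨k, hk⟩ := exists_nat_one_div_lt (sub_pos.2 h)
          exact ⟨k, by linarith⟩
        · rintro ⟨k, hk⟩
          have : 0 < 1 / ((k : ℝ) + 1) := by positivity
          linarith
      rw [hU]
      refine le_of_tendsto' (tendsto_measure_iUnion_atTop (μ := μ)
        (s := fun k : ℕ => {x | b x ≤ sInf S - 1 / ((k : ℝ) + 1)}) ?_) ?_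
      · intro i j hij x hx
        have := hanti hij
        simp only [Set.mem_ofPred_eq] at hx ⊢
        simp only at this
        linarith
      · intro k
        have hpos : 0 < 1 / ((k : ℝ) + 1) := by positivity
        have hn : sInf S - 1 / ((k : ℝ) + 1) ∉ S := fun h => by
          have := csInf_le hbdd h
          linarith
        exact (not_le.1 hn).le
    have hc : {x | sInf S ≤ b x} = {x | b x < sInf S}ᶜ := by
      ext x; simp
    rw [hc, measure_compl (measurableSet_lt hb measurable_const) (measure_ne_top _ _)]
    refine ENNReal.le_sub_of_add_le_left (measure_ne_top _ _) ?_
    calc _ ≤ μ Set.univ / 2 + μ Set.univ / 2 := by gcongr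
      _ = _ := ENNReal.add_halves _


/-- One half of the oscillation estimate. -/
lemma core_half {n : ℕ} (p : ℝ) (hp : 1 < p) (Ω : En n → ℝ)
    (hΩc : ContinuousOn Ω {(0 : En n)}ᶜ)
    (T : (En n → ℂ) → (En n → ℂ)) (b : En n → ℝ) (M : ℝ)
    (hb : LocallyIntegrable b volume)
    (hT : ∀ f : En n → ℂ, Integrable f → HasCompactSupport f →
          ∀ᵐ x : En n, x ∉ tsupport f →
            T f x = ∫ y, ((Ω (x - y) / ‖x - y‖ ^ n : ℝ) : ℂ) * f y)
    (hM : 0 ≤ M)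
    (hw : ∀ f : En n → ℂ, Measurable f → (∃ D : ℝ, ∀ x, ‖f x‖ ≤ D) →
          (∃ (c : En n) (r : ℝ), 0 < r ∧ ∀ x, x ∉ cube c r → f x = 0) →
          weakLpNorm p (fun x => (b x : ℂ) * T f x - T (fun y => (b y : ℂ) * f y) x) ≤
            ENNReal.ofReal M * eLpNorm f (ENNReal.ofReal p) volume)
    (c : En n) (r : ℝ) (hr : 0 < r) (κ s σ α : ℝ) (hκ : 0 ≤ κ) (hs : |s| = 1) (hσ : |σ| = 1)
    (E F : Set (En n)) (hF : MeasurableSet F) (hFQ : F ⊆ cube c r)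
    (hk : ∀ x ∈ E, ∀ y ∈ ccube c r, x - y ≠ 0 ∧ κ ≤ s * (Ω (x - y) / ‖x - y‖ ^ n))
    (hEv : volume (cube c r) / 2 ≤ volume E)
    (hE : ∀ᵐ x, x ∈ E → σ * (b x - α) ≤ 0)
    (hFα : ∀ᵐ y, y ∈ F → 0 ≤ σ * (b y - α)) :
    κ * ∫ y in F, σ * (b y - α) ≤ M * 2 ^ (1 / p) := by
  set V := volume (cube c r) with hV
  have hV0 : V ≠ 0 := by
    rw [hV, volume_cube c r hr]; exact (ENNReal.ofReal_pos.2 (by positivity)).ne'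
  have hVt : V ≠ ∞ := by rw [hV, volume_cube c r hr]; exact ENNReal.ofReal_ne_top
  have hFC : F ⊆ ccube c r := hFQ.trans (cube_subset_ccube c r)
  have hFfin : volume F ≠ ∞ := ne_top_of_le_ne_top hVt (measure_mono hFQ)
  have hbC : IntegrableOn b (ccube c r) := hb.integrableOn_isCompact (isCompact_ccube c r)
  set f : En n → ℂ := F.indicator fun _ => (1 : ℂ) with hf
  have hfm : Measurable f := measurable_const.indicator hF
  have hfi : Integrable f := (integrable_indicator_iff hF).2 (integrableOn_const hFfin)
  have hbf : (fun y => (b y : ℂ) * f y) = F.indicator fun y => (b y : ℂ) := by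
    ext y; by_cases hy : y ∈ F <;> simp [hf, hy]
  have hbfi : Integrable (fun y => (b y : ℂ) * f y) := by
    rw [hbf, integrable_indicator_iff hF]
    exact (hbC.mono_set hFC).ofReal
  have hts : tsupport f ⊆ ccube c r :=
    closure_minimal (Set.support_indicator_subset.trans hFC) (isClosed_ccube c r)
  have hbts : tsupport (fun y => (b y : ℂ) * f y) ⊆ ccube c r := by
    rw [hbf]
    exact closure_minimal (Set.support_indicator_subset.trans hFC) (isClosed_ccube c r)
  have hfc : HasCompactSupport f :=
    (isCompact_ccube c r).of_isClosed_subset (isClosed_tsupport _) hts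
  have hbfc : HasCompactSupport (fun y => (b y : ℂ) * f y) :=
    (isCompact_ccube c r).of_isClosed_subset (isClosed_tsupport _) hbts
  set g : En n → ℂ := fun x => (b x : ℂ) * T f x - T (fun y => (b y : ℂ) * f y) x with hg
  set I : ℝ := κ * ∫ y in F, σ * (b y - α) with hI
  have key : ∀ᵐ x, x ∈ E → I ≤ ‖g x‖ := by
    filter_upwards [hT f hfi hfc, hT _ hbfi hbfc, hE] with x h1 h2 h3 hxE
    have hxC : x ∉ ccube c r := fun hx => (hk x hxE x hx).1 (sub_self x)
    have h1 := h1 fun h => hxC (hts h)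
    have h2 := h2 fun h => hxC (hbts h)
    have h3 := h3 hxE
    set k : En n → ℝ := fun y => Ω (x - y) / ‖x - y‖ ^ n with hkdef
    have hkc : ContinuousOn k (ccube c r) := by
      apply ContinuousOn.div
      · refine hΩc.comp (by fun_prop) ?_
        intro y hy
        exact (hk x hxE y hy).1
      · fun_prop
      · intro y hy
        exact pow_ne_zero _ (norm_ne_zero_iff.2 (hk x hxE y hy).1)
    have hki : IntegrableOn k F :=
      (hkc.integrableOn_compact (isCompact_ccube c r)).mono_set hFC
    have hkbi : IntegrableOn (fun y => k y * b y) F :=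
      (hbC.continuousOn_mul hkc (isCompact_ccube c r)).mono_set hFC
    have e1 : T f x = ((∫ y in F, k y : ℝ) : ℂ) := by
      rw [h1, ← integral_indicator hF, ← integral_complex_ofReal]
      congr 1; ext y; by_cases hy : y ∈ F <;> simp [hf, hy, hkdef]
    have e2 : T (fun y => (b y : ℂ) * f y) x = ((∫ y in F, k y * b y : ℝ) : ℂ) := by
      rw [h2, ← integral_indicator hF, ← integral_complex_ofReal]
      congr 1; ext y; by_cases hy : y ∈ F <;> simp [hf, hy, hkdef]
    have e3 : ‖g x‖ = |∫ y in F, s * k y * (σ * (b y - b x))| := by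
      have e4 : (∫ y in F, s * k y * (σ * (b y - b x)))
          = - (s * σ * (b x * (∫ y in F, k y) - ∫ y in F, k y * b y)) := by
        rw [← integral_const_mul (b x), ← integral_sub (hki.const_mul _) hkbi,
          ← integral_const_mul, ← integral_neg]
        congr 1; ext y; ring
      rw [e4, abs_neg, abs_mul, abs_mul, hs, hσ, one_mul, one_mul]
      simp only [hg]
      rw [e1, e2, ← Complex.ofReal_mul, ← Complex.ofReal_sub, Complex.norm_real,
        Real.norm_eq_abs]
    rw [e3, hI, ← integral_const_mul]
    refine le_trans ?_ (le_abs_self _)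
    have hbF : IntegrableOn b F := hbC.mono_set hFC
    refine integral_mono_ae ?_ ?_ ?_
    · exact ((hbF.sub (integrableOn_const hFfin)).const_mul σ).const_mul κ
    · have : (fun y => s * k y * (σ * (b y - b x)))
          = fun y => s * σ * (k y * b y) - s * σ * b x * k y := by ext y; ring
      rw [this]
      exact (hkbi.const_mul _).sub (hki.const_mul _)
    · filter_upwards [ae_restrict_of_ae hFα, ae_restrict_mem hF] with y hy hyF
      have hy := hy hyF
      have hky := (hk x hxE y (hFC hyF)).2
      have : σ * (b y - α) ≤ σ * (b y - b x) := by nlinarith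
      exact mul_le_mul hky this hy (hκ.trans hky)
  have hfin := hw f hfm ⟨1, fun x => by
    by_cases hx : x ∈ F <;> simp [hf, hx]⟩ ⟨c, r, hr, fun x hx => by
      rw [hf, Set.indicator_of_notMem (fun h => hx (hFQ h))]⟩
  have hp0 : 0 < p := by linarith
  have hfn : eLpNorm f (ENNReal.ofReal p) volume ≤ V ^ (1 / p) := by
    rw [hf, eLpNorm_indicator_const hF (ENNReal.ofReal_pos.2 hp0).ne' ENNReal.ofReal_ne_top,
      ENNReal.toReal_ofReal hp0.le]
    simp only [enorm_one, one_mul]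
    exact ENNReal.rpow_le_rpow (measure_mono hFQ) (by positivity)
  refine le_of_forall_lt_imp_le_of_dense fun t ht => ?_
  rcases le_or_gt t 0 with ht0 | ht0
  · exact ht0.trans (by positivity)
  have hEg : volume E ≤ volume {x | t < ‖g x‖} := by
    apply measure_mono_ae
    filter_upwards [key] with x hx hxE
    exact lt_of_lt_of_le ht (hx hxE)
  have h5 : ENNReal.ofReal t * (V / 2) ^ (1 / p) ≤ ENNReal.ofReal M * V ^ (1 / p) := by
    calc _ ≤ ENNReal.ofReal t * volume {x | t < ‖g x‖} ^ (1 / p) := by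
          gcongr
          exact hEv.trans hEg
      _ ≤ weakLpNorm p g := le_iSup₂ (f := fun (t : ℝ) (_ : 0 < t) =>
          ENNReal.ofReal t * volume {x : En n | t < ‖g x‖} ^ (1 / p)) t ht0
      _ ≤ _ := hfin.trans (by gcongr)
  have h6 : V ^ (1 / p) = 2 ^ (1 / p) * (V / 2) ^ (1 / p) := by
    rw [← ENNReal.mul_rpow_of_nonneg _ _ (by positivity),
      ENNReal.mul_div_cancel (by simp) (by simp)]
  rw [h6, ← mul_assoc] at h5
  have h7 : (V / 2) ^ (1 / p) ≠ 0 := by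
    rw [Ne, ENNReal.rpow_eq_zero_iff_of_pos (by positivity)]
    exact (ENNReal.half_pos hV0).ne'
  have h8 : (V / 2) ^ (1 / p) ≠ ∞ :=
    ENNReal.rpow_ne_top_of_nonneg (by positivity) (ENNReal.div_ne_top hVt (by simp))
  have h9 := (ENNReal.mul_le_mul_iff_left h7 h8).1 h5
  rw [show (2 : ℝ≥0∞) = ENNReal.ofReal 2 by simp, ENNReal.ofReal_rpow_of_pos (by norm_num),
    ← ENNReal.ofReal_mul hM] at h9
  exact (ENNReal.ofReal_le_ofReal_iff (by positivity)).1 h9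

/-- If `1 < p < ∞` and `‖[b,T]f‖_{L^{p,∞}} ≤ M ‖f‖_{L^p}` for all bounded
measurable `f` supported in a cube, then `b ∈ BMO` with `‖b‖_* ≤ C M`, where `C` depends
only on `n`, `p` and `Ω`. -/
theorem bmo_of_commutator_weak_Lp_bound (n : ℕ) (p : ℝ) (hp : 1 < p)
    (Ω : En n → ℝ)
    (hΩhom : ∀ l : ℝ, 0 < l → ∀ x : En n, x ≠ 0 → Ω (l • x) = Ω x)
    (hΩsmooth : ContDiffOn ℝ (⊤ : ℕ∞) Ω {(0 : En n)}ᶜ)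
    (hΩne : ∃ x : En n, x ≠ 0 ∧ Ω x ≠ 0)
    (hΩzero : ∫ θ : Metric.sphere (0 : En n) 1, Ω (θ : En n)
        ∂(volume : Measure (En n)).toSphere = 0) :
    ∃ C : ℝ, 0 < C ∧
      ∀ (T : (En n → ℂ) → (En n → ℂ)) (b : En n → ℝ) (M : ℝ),
        LocallyIntegrable b volume →
        (∀ f : En n → ℂ, Integrable f → HasCompactSupport f →
          ∀ᵐ x : En n, x ∉ tsupport f →
            T f x = ∫ y, ((Ω (x - y) / ‖x - y‖ ^ n : ℝ) : ℂ) * f y) →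
        0 ≤ M →
        (∀ f : En n → ℂ, Measurable f → (∃ D : ℝ, ∀ x, ‖f x‖ ≤ D) →
          (∃ (c : En n) (r : ℝ), 0 < r ∧ ∀ x, x ∉ cube c r → f x = 0) →
          weakLpNorm p (fun x => (b x : ℂ) * T f x - T (fun y => (b y : ℂ) * f y) x) ≤
            ENNReal.ofReal M * eLpNorm f (ENNReal.ofReal p) volume) →
        bmoSeminorm b ≤ ENNReal.ofReal (C * M) := by
  obtain ⟨x0, hx0, hΩ0⟩ := hΩne
  have hΩc : ContinuousOn Ω {(0 : En n)}ᶜ := hΩsmooth.continuousOn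
  obtain ⟨A, κ, s, hA, hκ, hs, hker⟩ := kernel_lower Ω hΩhom hΩc x0 hx0 hΩ0
  refine ⟨4 * 2 ^ (1 / p) / (κ * 2 ^ n), by positivity, ?_⟩
  intro T b M hb hT hM hw
  refine iSup_le fun c => iSup_le fun r => iSup_le fun hr => ?_
  obtain ⟨b', hb', hbb'⟩ : ∃ b' : En n → ℝ, Measurable b' ∧ b =ᵐ[volume] b' :=
    ⟨hb.aestronglyMeasurable.aemeasurable.mk b, AEMeasurable.measurable_mk _,
      AEMeasurable.ae_eq_mk _⟩
  have hvol : ∀ c : En n, volume (cube c r) = ENNReal.ofReal ((2 * r) ^ n) :=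
    fun c => volume_cube c r hr
  set Q := cube c r with hQ
  have hQm : MeasurableSet Q := (isOpen_cube c r).measurableSet
  have hQv : volume Q = ENNReal.ofReal ((2 * r) ^ n) := hvol c
  have hQt : volume Q ≠ ∞ := by rw [hQv]; exact ENNReal.ofReal_ne_top
  set Q' := cube (c + (A * r) • x0) r with hQ'
  have hQ'v : volume Q' = volume Q := by rw [hvol, hvol]
  have : IsFiniteMeasure (volume.restrict Q') :=
    ⟨by rw [Measure.restrict_apply_univ, hQ'v]; exact lt_top_iff_ne_top.2 hQt⟩
  obtain ⟨α, hα1, hα2⟩ := exists_median (volume.restrict Q') b' hb'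
  rw [Measure.restrict_apply_univ, hQ'v,
    Measure.restrict_apply (measurableSet_le hb' measurable_const)] at hα1
  rw [Measure.restrict_apply_univ, hQ'v,
    Measure.restrict_apply (measurableSet_le measurable_const hb')] at hα2
  set F1 : Set (En n) := Q ∩ {y | α < b' y} with hF1
  set F2 : Set (En n) := Q \ {y | α < b' y} with hF2
  have hSm : MeasurableSet {y | α < b' y} := measurableSet_lt measurable_const hb'
  have hκr : 0 < κ / r ^ n := by positivity
  have I1 := core_half p hp Ω hΩc T b M hb hT hM hw c r hr (κ / r ^ n) s 1 α hκr.le hs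
    (by simp) ({x | b' x ≤ α} ∩ Q') F1 (hQm.inter hSm) Set.inter_subset_left
    (fun x hx y hy => hker c r hr x hx.2 y hy) hα1
    (by filter_upwards [hbb'] with x hx hxE
        have : b' x ≤ α := hxE.1
        rw [hx]; linarith)
    (by filter_upwards [hbb'] with x hx hxE
        have : α < b' x := hxE.2
        rw [hx]; linarith)
  have I2 := core_half p hp Ω hΩc T b M hb hT hM hw c r hr (κ / r ^ n) s (-1) α hκr.le hs
    (by simp) ({x | α ≤ b' x} ∩ Q') F2 (hQm.diff hSm) Set.sdiff_subset
    (fun x hx y hy => hker c r hr x hx.2 y hy) hα2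
    (by filter_upwards [hbb'] with x hx hxE
        have : α ≤ b' x := hxE.1
        rw [hx]; linarith)
    (by filter_upwards [hbb'] with x hx hxE
        have : ¬ (α < b' x) := hxE.2
        rw [hx]; linarith)
  have hbQ : IntegrableOn b Q := (hb.integrableOn_isCompact (isCompact_ccube c r)).mono_set
    (cube_subset_ccube c r)
  have hbα : ∀ a : ℝ, IntegrableOn (fun y => b y - a) Q :=
    fun a => hbQ.sub (integrableOn_const hQt)
  have hsum : ∫ y in Q, |b y - α| = (∫ y in F1, 1 * (b y - α)) + ∫ y in F2, -1 * (b y - α) := by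
    rw [← integral_inter_add_sdiff hSm (hbα α).abs]
    congr 1
    · refine setIntegral_congr_ae (hQm.inter hSm) ?_
      filter_upwards [hbb'] with x hx hxE
      have : α < b' x := hxE.2
      rw [one_mul, abs_of_nonneg]
      rw [hx]; linarith
    · refine setIntegral_congr_ae (hQm.diff hSm) ?_
      filter_upwards [hbb'] with x hx hxE
      have : ¬ (α < b' x) := hxE.2
      rw [abs_of_nonpos]
      · ring
      rw [hx]; linarith
  have hJ : κ / r ^ n * ∫ y in Q, |b y - α| ≤ 2 * (M * 2 ^ (1 / p)) := by
    rw [hsum, mul_add]; linarith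
  set J := ∫ y in Q, |b y - α| with hJdef
  set V : ℝ := (2 * r) ^ n with hVdef
  have hVpos : 0 < V := by positivity
  have hVr : volume.real Q = V := by
    rw [Measure.real, hQv, ENNReal.toReal_ofReal hVpos.le]
  set a := cubeAvg b c r with ha
  have haV : V * |α - a| ≤ J := by
    have e : V * (a - α) = ∫ y in Q, (b y - α) := by
      rw [integral_sub hbQ (integrableOn_const hQt), setIntegral_const, hVr, smul_eq_mul, ha,
        cubeAvg, ← hQ, hQv, ENNReal.toReal_ofReal hVpos.le]
      field_simp
    rw [abs_sub_comm, ← abs_of_pos hVpos, ← abs_mul, e]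
    exact abs_integral_le_integral_abs
  have hfinal : ∫ y in Q, |b y - a| ≤ 2 * J := by
    calc ∫ y in Q, |b y - a| ≤ ∫ y in Q, (|b y - α| + |α - a|) := by
          refine integral_mono (hbα a).abs ((hbα α).abs.add (integrableOn_const hQt)) ?_
          intro y
          exact abs_sub_le _ _ _
      _ = J + V * |α - a| := by
          rw [integral_add (hbα α).abs (integrableOn_const hQt), setIntegral_const, hVr,
            smul_eq_mul]
      _ ≤ 2 * J := by linarith
  have hl : ∫⁻ x in Q, (‖b x - a‖₊ : ℝ≥0∞) = ENNReal.ofReal (∫ y in Q, |b y - a|) :=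
    (ofReal_integral_norm_eq_lintegral_enorm (hbα a)).symm
  rw [hl, hQv, ← ENNReal.ofReal_inv_of_pos hVpos, ← ENNReal.ofReal_mul (by positivity)]
  apply ENNReal.ofReal_le_ofReal
  have hJ2 : J ≤ 2 * (M * 2 ^ (1 / p)) * r ^ n / κ := by
    rw [le_div_iff₀ hκ]
    rw [div_mul_eq_mul_div, div_le_iff₀ (by positivity)] at hJ
    linarith
  calc V⁻¹ * ∫ y in Q, |b y - a| ≤ V⁻¹ * (2 * (2 * (M * 2 ^ (1 / p)) * r ^ n / κ)) := by
        gcongr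
        linarith
    _ = _ := by
        rw [hVdef, mul_pow]
        field_simp
        ring
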